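/- If g ∈ Γ is an element of infinite order, then r(g) < 1. -/

import Mathlib

open Filter Topology MeasureTheory
open scoped ENNReal

namespace HarmonicBoundary

variable {Γ : Type} [Group Γ]

/-- Word length of `g` with respect to a generating set `S`. -/
noncomputable def wl (S : Set Γ) (g : Γ) : ℕ :=
  sInf {n : ℕ | ∃ w : List Γ, w.length = n ∧ (∀ x ∈ w, x ∈ S) ∧ w.prod = g}

/-- Word metric `d(x,y) = |x⁻¹y|`. -/
noncomputable def wdist (S : Set Γ) (x y : Γ) : ℕ := wl S (x⁻¹ * y)

/-- Gromov product `(x|y)_z = (d(x,z)+d(y,z)-d(x,y))/2`. -/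
noncomputable def gp (S : Set Γ) (z x y : Γ) : ℝ :=
  ((wdist S x z : ℝ) + (wdist S y z : ℝ) - (wdist S x y : ℝ)) / 2

/-- `S` is a finite symmetric generating set of `Γ`. -/
def IsGenSet (S : Set Γ) : Prop :=
  S.Finite ∧ (∀ s ∈ S, s⁻¹ ∈ S) ∧ Subgroup.closure S = ⊤

/-- `Γ` is `δ`-hyperbolic with respect to the word metric of `S`:
`(x|y) ≥ min ((x|z), (y|z)) - δ` for all `x y z`. -/
def IsHyperbolic (S : Set Γ) (δ : ℝ) : Prop :=
  0 ≤ δ ∧ ∀ x y z : Γ, min (gp S 1 x z) (gp S 1 y z) - δ ≤ gp S 1 x y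

/-- `Γ` is nonelementary: it has no cyclic subgroup of finite index. -/
def Nonelementary (Γ : Type) [Group Γ] : Prop :=
  ∀ g : Γ, (Subgroup.zpowers g).index = 0

/-- A sequence converges to infinity if `(x_i|x_j) → ∞`. -/
def ConvInf (S : Set Γ) (u : ℕ → Γ) : Prop :=
  Tendsto (fun p : ℕ × ℕ => gp S 1 (u p.1) (u p.2)) atTop atTop

/-- Two sequences converging to infinity are equivalent if `(x_i|y_j) → ∞`. -/
def EquivSeq (S : Set Γ) (u v : ℕ → Γ) : Prop :=
  Tendsto (fun p : ℕ × ℕ => gp S 1 (u p.1) (v p.2)) atTop atTop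

/-- An (abstract model of the) Gromov boundary of `Γ`: the points are exactly the
classes of sequences converging to infinity, modulo the equivalence `EquivSeq`,
together with the natural left action of `Γ`. -/
structure Boundary (Γ : Type) [Group Γ] (S : Set Γ) where
  pt : Type
  cls : (ℕ → Γ) → pt
  cls_surj : ∀ ξ : pt, ∃ u : ℕ → Γ, ConvInf S u ∧ cls u = ξ
  cls_eq : ∀ u v : ℕ → Γ, ConvInf S u → ConvInf S v → (cls u = cls v ↔ EquivSeq S u v)
  smul : Γ → pt → pt
  smul_cls : ∀ (g : Γ) (u : ℕ → Γ), ConvInf S u → smul g (cls u) = cls fun n => g * u n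

/-- Extension of the Gromov product to the boundary:
`(ξ|η) = sup liminf (x_i|y_j)` over sequences representing `ξ` and `η`,
as an extended nonnegative real. -/
noncomputable def bgp {S : Set Γ} (B : Boundary Γ S) (ξ η : B.pt) : ℝ≥0∞ :=
  ⨆ (u : {u : ℕ → Γ // ConvInf S u ∧ B.cls u = ξ})
    (v : {v : ℕ → Γ // ConvInf S v ∧ B.cls v = η}),
    Filter.liminf (fun p : ℕ × ℕ => ENNReal.ofReal (gp S 1 (u.1 p.1) (v.1 p.2))) atTop

/-- Real-valued Gromov product on the boundary (finite for `ξ ≠ η`). -/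
noncomputable def bgpR {S : Set Γ} (B : Boundary Γ S) (ξ η : B.pt) : ℝ := (bgp B ξ η).toReal

/-- The canonical topology of the Gromov boundary: a set is open iff around each of
its points it contains a basic neighbourhood `V_r(p) = {q | (q|p) > r}`. -/
def btop {S : Set Γ} (B : Boundary Γ S) : TopologicalSpace B.pt where
  IsOpen O := ∀ p ∈ O, ∃ r : ℝ≥0∞, r ≠ ⊤ ∧ {q | r < bgp B q p} ⊆ O
  isOpen_univ := fun p _ => ⟨0, ENNReal.zero_ne_top, fun q _ => trivial⟩
  isOpen_inter := by
    intro A A' hA hA' p hp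
    obtain ⟨r1, hr1, h1⟩ := hA p hp.1
    obtain ⟨r2, hr2, h2⟩ := hA' p hp.2
    refine ⟨max r1 r2, (max_lt hr1.lt_top hr2.lt_top).ne, fun q hq => ?_⟩
    have hq' : max r1 r2 < bgp B q p := hq
    exact ⟨h1 (show r1 < bgp B q p from (le_max_left r1 r2).trans_lt hq'),
      h2 (show r2 < bgp B q p from (le_max_right r1 r2).trans_lt hq')⟩
  isOpen_sUnion := by
    intro s hs p hp
    obtain ⟨t, ht, hpt⟩ := hp
    obtain ⟨r, hr, hsub⟩ := hs t ht p hpt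
    exact ⟨r, hr, fun q hq => ⟨t, ht, hsub hq⟩⟩

/-- The attracting fixed point `g⁺ = lim_n gⁿ` of an (infinite order) element. -/
def plusPt {S : Set Γ} (B : Boundary Γ S) (g : Γ) : B.pt := B.cls fun n => g ^ n

/-- The repelling fixed point `g⁻ = lim_n g⁻ⁿ` of an (infinite order) element. -/
def minusPt {S : Set Γ} (B : Boundary Γ S) (g : Γ) : B.pt := B.cls fun n => g⁻¹ ^ n

/-- A geodesic ray starting at the identity. -/
def IsGeodesicRay (S : Set Γ) (x : ℕ → Γ) : Prop :=
  x 0 = 1 ∧ ∀ m n : ℕ, wdist S (x m) (x n) = Nat.dist m n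

/-- A geodesic ray from `e` to the boundary point `ξ`, i.e. an element of `[e,ξ]`. -/
def RayTo {S : Set Γ} (B : Boundary Γ S) (x : ℕ → Γ) (ξ : B.pt) : Prop :=
  IsGeodesicRay S x ∧ ConvInf S x ∧ B.cls x = ξ

/-- A geodesic segment from `x` to `y` (parametrized on `0,…,d(x,y)`),
i.e. an element of `[x,y]`. -/
def IsGeodesicSeg (S : Set Γ) (x y : Γ) (α : ℕ → Γ) : Prop :=
  α 0 = x ∧ α (wdist S x y) = y ∧
  ∀ m n : ℕ, m ≤ wdist S x y → n ≤ wdist S x y → wdist S (α m) (α n) = Nat.dist m n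

/-- The boundary "cylinder" `U(ξ,R)`: all `η` such that for every pair of geodesic
rays `x ∈ [e,ξ]`, `y ∈ [e,η]` one has `lim_n (x(n)|y(n)) > R` (the sequence
`(x(n)|y(n))` is nondecreasing, so the limit exceeds `R` iff some term does). -/
def Uset {S : Set Γ} (B : Boundary Γ S) (ξ : B.pt) (R : ℝ) : Set B.pt :=
  {η | ∀ x y : ℕ → Γ, RayTo B x ξ → RayTo B y η → ∃ n : ℕ, R < gp S 1 (x n) (y n)}

/-- `C_r(p) = {g | (g|e)_p > r}`. -/
def Cset (S : Set Γ) (p : Γ) (r : ℝ) : Set Γ := {g | r < gp S p g 1}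

/-- The `R`-neighbourhood `N(α,R)` of a geodesic segment `α ∈ [x,y]`. -/
def segN (S : Set Γ) (x y : Γ) (α : ℕ → Γ) (R : ℝ) : Set Γ :=
  {g | ∃ i ≤ wdist S x y, (wdist S g (α i) : ℝ) ≤ R}

/-- The `R`-neighbourhood `N(A,R)` of a subset `A ⊆ Γ`. -/
def setN (S : Set Γ) (A : Set Γ) (R : ℝ) : Set Γ :=
  {g | ∃ a ∈ A, (wdist S g a : ℝ) ≤ R}

/-- `μ` is a nondegenerate probability measure on `Γ` with support contained in `S`:
nonnegative, of total mass one, supported in `S`, and the semigroup generated by its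
support is the whole of `Γ`. -/
structure IsRWMeasure (S : Set Γ) (μ : Γ → ℝ) : Prop where
  nonneg : ∀ g, 0 ≤ μ g
  support_subset : ∀ g, μ g ≠ 0 → g ∈ S
  total : ∑' g : Γ, μ g = 1
  nondeg : ∀ g : Γ, ∃ l : List Γ, l ≠ [] ∧ (∀ x ∈ l, 0 < μ x) ∧ l.prod = g

open Classical in
/-- `n`-step transition probabilities `p⁽ⁿ⁾(x,y) = μ*ⁿ(x⁻¹y)` of the random walk. -/
noncomputable def ptrans (μ : Γ → ℝ) : ℕ → Γ → Γ → ℝ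
  | 0 => fun x y => if x = y then 1 else 0
  | n + 1 => fun x y => ∑' z : Γ, ptrans μ n x z * μ (z⁻¹ * y)

/-- Green function `G(x,y) = Σ_n p⁽ⁿ⁾(x,y)`. -/
noncomputable def green (μ : Γ → ℝ) (x y : Γ) : ℝ := ∑' n : ℕ, ptrans μ n x y

/-- `F(x,y) = G(x,y)/G(y,y)`, the probability that the walk from `x` ever hits `y`. -/
noncomputable def greenF (μ : Γ → ℝ) (x y : Γ) : ℝ := green μ x y / green μ y y

/-- The Martin kernel `K(x,y) = G(x,y)/G(e,y)`. -/
noncomputable def martinK (μ : Γ → ℝ) (x y : Γ) : ℝ := green μ x y / green μ 1 y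

open Classical in
/-- Transition probabilities of the walk restricted to `Δ` (killed when leaving `Δ`). -/
noncomputable def ptransR (μ : Γ → ℝ) (Δ : Set Γ) : ℕ → Γ → Γ → ℝ
  | 0 => fun x y => if x = y ∧ x ∈ Δ then 1 else 0
  | n + 1 => fun x y => if y ∈ Δ then ∑' z : Γ, ptransR μ Δ n x z * μ (z⁻¹ * y) else 0

/-- Green function `G_Δ` of the restricted walk. -/
noncomputable def greenR (μ : Γ → ℝ) (Δ : Set Γ) (x y : Γ) : ℝ := ∑' n : ℕ, ptransR μ Δ n x y

/-- `F_Δ(x,y) = G_Δ(x,y)/G_Δ(y,y)`. -/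
noncomputable def greenFR (μ : Γ → ℝ) (Δ : Set Γ) (x y : Γ) : ℝ :=
  greenR μ Δ x y / greenR μ Δ y y

/-- Generating function `G_Δ(x,y|z) = Σ_n p_Δ⁽ⁿ⁾(x,y) zⁿ`. -/
noncomputable def greenRZ (μ : Γ → ℝ) (Δ : Set Γ) (x y : Γ) (z : ℝ) : ℝ :=
  ∑' n : ℕ, ptransR μ Δ n x y * z ^ n

/-- Spectral radius `ρ(P) = lim_n p⁽ⁿ⁾(e,e)^{1/n}` of the walk. -/
noncomputable def specRad (μ : Γ → ℝ) : ℝ :=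
  Filter.limsup (fun n : ℕ => (ptrans μ n 1 1) ^ ((n : ℝ)⁻¹)) atTop

/-- `u` is harmonic on `Λ`: `Σ_h p(g,h) u(h) = u(g)` for `g ∈ Λ`, `p(g,h)=μ(g⁻¹h)`. -/
def HarmonicOn (μ : Γ → ℝ) (u : Γ → ℝ) (Λ : Set Γ) : Prop :=
  ∀ g ∈ Λ, (∑' h : Γ, μ (g⁻¹ * h) * u h) = u g

/-- `u` vanishes at infinity on `Λ`: `u(g_n) → 0` along sequences in `Λ` with `|g_n|→∞`. -/
def VanishesAtInftyOn (S : Set Γ) (u : Γ → ℝ) (Λ : Set Γ) : Prop :=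
  ∀ ε : ℝ, 0 < ε → ∃ M : ℕ, ∀ g ∈ Λ, M ≤ wl S g → |u g| ≤ ε

open Classical in
/-- `r(g) = K(g⁻¹,g⁺)` for infinite order `g`, and `r(g) = 1` for finite order `g`;
here `Kb` is the boundary extension of the Martin kernel. -/
noncomputable def rfun {S : Set Γ} (B : Boundary Γ S) (Kb : Γ → B.pt → ℝ) (g : Γ) : ℝ :=
  if IsOfFinOrder g then 1 else Kb g⁻¹ (plusPt B g)

/-- The ratio set `r(Γ,∂Γ,ν)`: all `l ≥ 0` such that for every `ε > 0` and every
Borel `A` of positive measure there is `g ∈ Γ` such that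
`{ω ∈ gA ∩ A : |d(gν)/dν(ω) − l| < ε}` has positive measure; here the
Radon–Nikodym derivative `d(gν)/dν` is the Martin kernel `Kb g`. -/
def ratioSet {S : Set Γ} (B : Boundary Γ S) [MeasurableSpace B.pt]
    (ν : Measure B.pt) (Kb : Γ → B.pt → ℝ) : Set ℝ :=
  {l : ℝ | 0 ≤ l ∧ ∀ ε : ℝ, 0 < ε → ∀ A : Set B.pt, MeasurableSet A → 0 < ν A →
    ∃ g : Γ, 0 < ν {ω | ω ∈ A ∧ B.smul g⁻¹ ω ∈ A ∧ |Kb g ω - l| < ε}}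

/-- A left invariant finitely additive mean on `Γ`; `Γ` is amenable iff one exists. -/
structure InvariantMean (Γ : Type) [Group Γ] where
  m : Set Γ → ℝ
  nonneg : ∀ A, 0 ≤ m A
  total : m Set.univ = 1
  fin_add : ∀ A B : Set Γ, Disjoint A B → m (A ∪ B) = m A + m B
  invariant : ∀ (g : Γ) (A : Set Γ), m ((g * ·) ⁻¹' A) = m A


/-- Abstract hyperbolic length function on a group. -/
structure HypLen {Γ : Type} [Group Γ] (l : Γ → ℝ) (δ : ℝ) : Prop where
  del : 0 ≤ δ
  one : l 1 = 0
  inv : ∀ x, l x⁻¹ = l x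
  mul : ∀ x y, l (x * y) ≤ l x + l y
  fin : ∀ R : ℝ, {x | l x ≤ R}.Finite
  mid : ∀ x, ∃ y, l y + l (y⁻¹ * x) = l x ∧ |l y - l (y⁻¹ * x)| ≤ 1
  four : ∀ x y z w, l (x⁻¹ * y) + l (z⁻¹ * w) ≤
    max (l (x⁻¹ * z) + l (y⁻¹ * w)) (l (x⁻¹ * w) + l (y⁻¹ * z)) + 2 * δ

/-- distance attached to a length function -/
def dd {Γ : Type} [Group Γ] (l : Γ → ℝ) (x y : Γ) : ℝ := l (x⁻¹ * y)

theorem exists_word {Γ : Type} [Group Γ] {S : Set Γ} (hS : IsGenSet S) (g : Γ) :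
    ∃ w : List Γ, (∀ x ∈ w, x ∈ S) ∧ w.prod = g := by
  have hg : g ∈ Subgroup.closure S := by rw [hS.2.2]; trivial
  rw [← Subgroup.mem_toSubmonoid, Subgroup.closure_toSubmonoid] at hg
  obtain ⟨w, hw, hp⟩ := Submonoid.exists_list_of_mem_closure hg
  refine ⟨w, fun x hx => ?_, hp⟩
  rcases hw x hx with h | h
  · exact h
  · simpa using hS.2.1 _ (Set.mem_inv.1 h)

theorem wl_spec {Γ : Type} [Group Γ] {S : Set Γ} (hS : IsGenSet S) (g : Γ) :
    ∃ w : List Γ, w.length = wl S g ∧ (∀ x ∈ w, x ∈ S) ∧ w.prod = g := by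
  have : {n : ℕ | ∃ w : List Γ, w.length = n ∧ (∀ x ∈ w, x ∈ S) ∧ w.prod = g}.Nonempty := by
    obtain ⟨w, h1, h2⟩ := exists_word hS g
    exact ⟨w.length, w, rfl, h1, h2⟩
  exact Nat.sInf_mem this

theorem wl_le {Γ : Type} [Group Γ] {S : Set Γ} (w : List Γ) (h : ∀ x ∈ w, x ∈ S) :
    wl S w.prod ≤ w.length := Nat.sInf_le ⟨w, rfl, h, rfl⟩

theorem wl_one {Γ : Type} [Group Γ] {S : Set Γ} : wl S (1 : Γ) = 0 := by
  have := wl_le (S := S) ([] : List Γ) (by simp)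
  simpa using this

theorem wl_mul {Γ : Type} [Group Γ] {S : Set Γ} (hS : IsGenSet S) (x y : Γ) :
    wl S (x * y) ≤ wl S x + wl S y := by
  obtain ⟨u, hu, hu1, rfl⟩ := wl_spec hS x
  obtain ⟨v, hv, hv1, rfl⟩ := wl_spec hS y
  have := wl_le (S := S) (u ++ v) (by
    intro x hx
    rcases List.mem_append.1 hx with h | h
    · exact hu1 x h
    · exact hv1 x h)
  rw [List.prod_append, List.length_append] at this
  omega

theorem wl_inv_le {Γ : Type} [Group Γ] {S : Set Γ} (hS : IsGenSet S) (x : Γ) :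
    wl S x⁻¹ ≤ wl S x := by
  obtain ⟨u, hu, hu1, hp⟩ := wl_spec hS x
  have := wl_le (S := S) ((u.map (fun x => x⁻¹)).reverse) (by
    intro x hx
    simp only [List.mem_reverse, List.mem_map] at hx
    obtain ⟨a, ha, rfl⟩ := hx
    exact hS.2.1 _ (hu1 a ha))
  rw [← List.prod_inv_reverse, hp] at this
  simpa [hu] using this

theorem wl_inv {Γ : Type} [Group Γ] {S : Set Γ} (hS : IsGenSet S) (x : Γ) :
    wl S x⁻¹ = wl S x := by
  apply le_antisymm (wl_inv_le hS x)
  simpa using wl_inv_le hS x⁻¹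

theorem wl_ball {Γ : Type} [Group Γ] {S : Set Γ} (hS : IsGenSet S) (n : ℕ) :
    {x : Γ | wl S x ≤ n}.Finite := by
  have := hS.1.to_subtype
  have h2 : {l : List S | l.length ≤ n}.Finite := List.finite_length_le S n
  refine (h2.image (fun l => (l.map Subtype.val).prod)).subset ?_
  intro x hx
  obtain ⟨u, hu, hu1, hp⟩ := wl_spec hS x
  refine ⟨u.attach.map (fun a => ⟨a.1, hu1 _ a.2⟩), ?_, ?_⟩
  · simp only [Set.mem_ofPred_eq, List.length_map, List.length_attach]
    exact hu ▸ hx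
  · simp only [List.map_map]
    rw [← hp]
    congr 1
    exact List.attach_map_subtype_val u

theorem wl_mid {Γ : Type} [Group Γ] {S : Set Γ} (hS : IsGenSet S) (x : Γ) (m : ℕ)
    (hm : m ≤ wl S x) : ∃ y, wl S y = m ∧ wl S (y⁻¹ * x) = wl S x - m := by
  obtain ⟨u, hu, hu1, hp⟩ := wl_spec hS x
  have h1 := wl_le (S := S) (u.take m) (fun x hx => hu1 x (List.mem_of_mem_take hx))
  have h2 := wl_le (S := S) (u.drop m) (fun x hx => hu1 x (List.mem_of_mem_drop hx))
  have h3 : (u.take m).prod * (u.drop m).prod = x := by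
    rw [← List.prod_append, List.take_append_drop, hp]
  have h4 : (u.take m).prod⁻¹ * x = (u.drop m).prod := by rw [← h3]; group
  have h5 := wl_mul hS (u.take m).prod (u.drop m).prod
  rw [h3] at h5
  simp only [List.length_take, List.length_drop, hu] at h1 h2
  refine ⟨(u.take m).prod, ?_, ?_⟩
  · omega
  · rw [h4]; omega

theorem hypLen_wl {Γ : Type} [Group Γ] {S : Set Γ} {δ : ℝ} (hS : IsGenSet S)
    (hδ : IsHyperbolic S δ) : HypLen (fun x => (wl S x : ℝ)) δ where
  del := hδ.1
  one := by simp [wl_one]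
  inv := fun x => by simp [wl_inv hS]
  mul := fun x y => by exact_mod_cast wl_mul hS x y
  fin := fun R => by
    refine (wl_ball hS ⌊R⌋₊).subset ?_
    intro x hx
    exact Nat.le_floor hx
  mid := fun x => by
    obtain ⟨y, h1, h2⟩ := wl_mid hS x (wl S x / 2) (Nat.div_le_self _ _)
    refine ⟨y, ?_, ?_⟩
    · rw [h1, h2]; norm_cast; omega
    · rw [h1, h2]
      have e : wl S x - wl S x / 2 = wl S x / 2 ∨ wl S x - wl S x / 2 = wl S x / 2 + 1 := by omega
      rcases e with e | e <;> rw [e] <;> simp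
  four := fun x y z w => by
    have h := hδ.2 (w⁻¹ * x) (w⁻¹ * y) (w⁻¹ * z)
    simp only [gp, wdist, mul_inv_rev, inv_inv, mul_one, mul_assoc, mul_inv_cancel_left] at h
    have e1 : (wl S (z⁻¹ * y) : ℝ) = wl S (y⁻¹ * z) := by
      rw [← wl_inv hS (z⁻¹ * y)]; simp
    rcases le_total ((wl S (x⁻¹ * z) : ℝ) + wl S (y⁻¹ * w)) (wl S (x⁻¹ * w) + wl S (y⁻¹ * z)) with h1 | h1
    · rw [max_eq_right h1]
      rw [sub_le_iff_le_add, min_le_iff] at h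
      rcases h with h | h <;> linarith
    · rw [max_eq_left h1]
      rw [sub_le_iff_le_add, min_le_iff] at h
      rcases h with h | h <;> linarith

section geom
variable {Γ : Type} [Group Γ] {l : Γ → ℝ} {δ : ℝ}

theorem HypLen.nonneg (h : HypLen l δ) (x : Γ) : 0 ≤ l x := by
  have := h.mul x x⁻¹
  rw [h.inv, mul_inv_cancel, h.one] at this
  linarith

theorem dd_symm (h : HypLen l δ) (x y : Γ) : dd l x y = dd l y x := by
  unfold dd; rw [← h.inv]; simp

theorem dd_tri (h : HypLen l δ) (x y z : Γ) : dd l x z ≤ dd l x y + dd l y z := by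
  unfold dd
  have := h.mul (x⁻¹ * y) (y⁻¹ * z)
  rwa [show x⁻¹ * y * (y⁻¹ * z) = x⁻¹ * z by group] at this

theorem dd_left (a x y : Γ) : dd l (a * x) (a * y) = dd l x y := by
  unfold dd; congr 1; group

theorem dd_one_left (x : Γ) : dd l 1 x = l x := by simp [dd]

theorem dd_one_right (h : HypLen l δ) (x : Γ) : dd l x 1 = l x := by simp [dd, h.inv]

theorem dd_nonneg (h : HypLen l δ) (x y : Γ) : 0 ≤ dd l x y := h.nonneg _

/-- four point inequality, as a disjunction -/
theorem dd_four (h : HypLen l δ) (x y z w : Γ) :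
    dd l x y + dd l z w ≤ dd l x z + dd l y w + 2 * δ ∨
    dd l x y + dd l z w ≤ dd l x w + dd l y z + 2 * δ := by
  have := h.four x y z w
  unfold dd
  rcases le_total (l (x⁻¹ * z) + l (y⁻¹ * w)) (l (x⁻¹ * w) + l (y⁻¹ * z)) with h1 | h1
  · right; rwa [max_eq_right h1] at this
  · left; rwa [max_eq_left h1] at this

theorem len_pow_le (h : HypLen l δ) (g : Γ) (n : ℕ) : l (g ^ n) ≤ n * l g := by
  induction n with
  | zero => simp [h.one]
  | succ n ih =>
    have := h.mul (g ^ n) g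
    rw [pow_succ]; push_cast; linarith

theorem dd_pow (h : HypLen l δ) (g y : Γ) (a b : ℕ) (hab : a ≤ b) :
    dd l (g ^ a * y) (g ^ b * y) = dd l y (g ^ (b - a) * y) := by
  obtain ⟨c, rfl⟩ := Nat.exists_eq_add_of_le hab
  rw [pow_add, mul_assoc, dd_left]; simp

theorem lox_super (h : HypLen l δ) (g y : Γ)
    (hK : dd l y (g * y) + (3 * δ + 1) ≤ dd l y (g ^ 2 * y)) :
    ∃ C, ∀ m n : ℕ, l (g ^ m) + l (g ^ n) ≤ l (g ^ (m + n)) + C := by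
  have hδ := h.del
  set L : ℕ → ℝ := fun n => dd l y (g ^ n * y) with hL
  have L0 : L 0 = 0 := by simp [hL, dd, h.one]
  have Lnn : ∀ n, 0 ≤ L n := fun n => h.nonneg _
  have hd : ∀ a b, a ≤ b → dd l (g ^ a * y) (g ^ b * y) = L (b - a) := fun a b => dd_pow h g y a b
  have hd' : ∀ a b, a ≤ b → dd l (g ^ b * y) (g ^ a * y) = L (b - a) := fun a b hab => by
    rw [dd_symm h, hd a b hab]
  have hK' : L 1 + (3 * δ + 1) ≤ L 2 := by simpa [hL] using hK
  have mono : ∀ n, L (n + 1) + (δ + 1) ≤ L (n + 2) := by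
    intro n
    induction n with
    | zero => simp only [zero_add]; linarith
    | succ n ih =>
      have q := dd_four h (g ^ 0 * y) (g ^ 2 * y) (g ^ 1 * y) (g ^ (n + 3) * y)
      rw [hd 0 2 (by omega), hd 1 (n+3) (by omega), hd 0 1 (by omega), hd 2 (n+3) (by omega),
        hd 0 (n+3) (by omega), hd' 1 2 (by omega)] at q
      simp only [show n + 3 - 1 = n + 2 by omega, show n + 3 - 2 = n + 1 by omega,
        show n + 3 - 0 = n + 3 by omega, show 2 - 0 = 2 by rfl, show 1 - 0 = 1 by rfl,
        show 2 - 1 = 1 by rfl] at q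
      show L (n + 2) + (δ + 1) ≤ L (n + 3)
      rcases q with q | q <;> linarith
  have mono' : ∀ n, L n ≤ L (n + 1) := by
    intro n
    rcases n with _ | n
    · rw [L0]; exact Lnn _
    · have := mono n
      show L (n+1) ≤ L (n+2)
      linarith
  have sup : ∀ m n, L m + L n ≤ L (m + n) + (L 1 + 2 * δ) := by
    intro m n
    have l1 := Lnn 1
    rcases m with _ | _ | m
    · simp only [zero_add]; rw [L0]; linarith
    · have := mono' n
      simp only [zero_add]; rw [add_comm 1 n]; linarith
    · rcases n with _ | n
      · rw [L0]; simp only [add_zero]; linarith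
      · have q := dd_four h (g ^ (m + 1) * y) (g ^ (m + 2 + (n + 1)) * y) (g ^ 0 * y) (g ^ (m + 2) * y)
        rw [hd (m+1) (m + 2 + (n+1)) (by omega), hd 0 (m+2) (by omega), hd' 0 (m+1) (by omega),
          hd' (m+2) (m + 2 + (n+1)) (by omega), hd (m+1) (m+2) (by omega),
          hd' 0 (m + 2 + (n+1)) (by omega)] at q
        simp only [show m + 2 + (n + 1) - (m + 1) = n + 2 by omega,
          show m + 2 + (n + 1) - (m + 2) = n + 1 by omega,
          show m + 2 - (m + 1) = 1 by omega, Nat.sub_zero] at q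
        have a1 := mono m
        have a2 := mono n
        show L (m + 2) + L (n + 1) ≤ L (m + 2 + (n + 1)) + (L 1 + 2 * δ)
        rcases q with q | q <;> linarith
  have cmp : ∀ n, |L n - l (g ^ n)| ≤ 2 * l y := by
    intro n
    have t1 : L n ≤ l y + l (g ^ n) + l y := by
      have a := h.mul (y⁻¹ * g ^ n) y
      have b := h.mul y⁻¹ (g ^ n)
      rw [h.inv] at b
      simp only [hL, dd]; rw [← mul_assoc]; linarith
    have t2 : l (g ^ n) ≤ l y + L n + l y := by
      have a := h.mul (y * (y⁻¹ * (g ^ n * y))) y⁻¹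
      have b := h.mul y (y⁻¹ * (g ^ n * y))
      rw [h.inv, show y * (y⁻¹ * (g ^ n * y)) * y⁻¹ = g ^ n by group] at a
      simp only [hL, dd]; linarith
    rw [abs_le]; constructor <;> linarith
  refine ⟨L 1 + 2 * δ + 6 * l y, fun m n => ?_⟩
  have c1 := abs_le.1 (cmp m)
  have c2 := abs_le.1 (cmp n)
  have c3 := abs_le.1 (cmp (m + n))
  have := sup m n
  linarith [c1.1, c1.2, c2.1, c2.2, c3.1, c3.2]

theorem root_super (h : HypLen l δ) (g : Γ) (i : ℕ) (hi : 0 < i)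
    (hs : ∃ C, ∀ m n : ℕ, l ((g ^ i) ^ m) + l ((g ^ i) ^ n) ≤ l ((g ^ i) ^ (m + n)) + C) :
    ∃ C, ∀ m n : ℕ, l (g ^ m) + l (g ^ n) ≤ l (g ^ (m + n)) + C := by
  obtain ⟨C, hC⟩ := hs
  have gn := h.nonneg g
  have key : ∀ q r : ℕ, r ≤ 2 * i → |l (g ^ (i * q + r)) - l ((g ^ i) ^ q)| ≤ 2 * i * l g := by
    intro q r hr
    have e : g ^ (i * q + r) = (g ^ i) ^ q * g ^ r := by rw [pow_add, pow_mul]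
    have a := h.mul ((g ^ i) ^ q) (g ^ r)
    have b := h.mul (g ^ (i * q + r)) (g ^ r)⁻¹
    rw [h.inv, e, mul_inv_cancel_right] at b
    have c := len_pow_le h g r
    have d : (r : ℝ) * l g ≤ 2 * i * l g :=
      mul_le_mul_of_nonneg_right (by exact_mod_cast hr) gn
    rw [e, abs_le]; constructor <;> linarith
  refine ⟨C + 6 * i * l g, fun m n => ?_⟩
  have k1 := key (m / i) (m % i) (by have := Nat.mod_lt m hi; omega)
  have k2 := key (n / i) (n % i) (by have := Nat.mod_lt n hi; omega)
  have k3 := key (m / i + n / i) (m % i + n % i)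
    (by have := Nat.mod_lt m hi; have := Nat.mod_lt n hi; omega)
  rw [show i * (m / i + n / i) + (m % i + n % i) = (i * (m / i) + m % i) + (i * (n / i) + n % i) by ring,
    Nat.div_add_mod, Nat.div_add_mod] at k3
  rw [Nat.div_add_mod] at k1 k2
  have := hC (m / i) (n / i)
  rw [abs_le] at k1 k2 k3
  linarith [k1.1, k1.2, k2.1, k2.2, k3.1, k3.2]

theorem exists_large (h : HypLen l δ) (g : Γ) (hg : ¬ IsOfFinOrder g) (R : ℝ) :
    ∃ n : ℕ, R < l (g ^ n) := by
  by_contra hc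
  push Not at hc
  have inj := (injective_pow_iff_not_isOfFinOrder (x := g)).2 hg
  have : (Set.range fun n : ℕ => g ^ n).Infinite := Set.infinite_range_of_injective inj
  exact this ((h.fin R).subset (by rintro _ ⟨n, rfl⟩; exact hc n))

theorem small_disp (h : HypLen l δ) (g v y : Γ) (hcomm : g * v = v * g)
    (h1 : l y + dd l y v = l v) (ha : 10 * l g + 20 * δ < l y) (hb : 10 * l g + 20 * δ < dd l y v)
    (hno : dd l y (g ^ 2 * y) < dd l y (g * y) + (3 * δ + 1)) :
    dd l y (g * y) ≤ 17 * δ + 1 := by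
  have hδ := h.del
  have gn := h.nonneg g
  have i1 := dd_four h g (g * v) 1 (g * y)
  have i2 := dd_four h 1 (g * v) v (g * y)
  have i3 := dd_four h y (g * y) 1 v
  have i4 := dd_four h 1 y g⁻¹ (g * y)
  have i5 := dd_four h 1 (g * y) g⁻¹ y
  have e1 : dd l g (g * v) = l v := by simp [dd]
  have e2 : dd l g (g * y) = l y := by simp [dd]
  have e3 : dd l v (g * v) = l g := by rw [hcomm]; simp [dd]
  have e3' : dd l (g * v) v = l g := by rw [dd_symm h, e3]
  have e4 : dd l g⁻¹ (g * y) = l (g ^ 2 * y) := by simp [dd, pow_two, mul_assoc]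
  have e5 : dd l g⁻¹ y = l (g * y) := by simp [dd]
  have e6 : dd l (g * v) (g * y) = dd l y v := by rw [dd_left, dd_symm h]
  simp only [dd_one_left, dd_one_right h, e1, e2, e3, e3', e4, e5, e6] at i1 i2 i3 i4 i5
  rw [dd_symm h y g⁻¹, e5, h.inv] at i4
  rw [dd_symm h (g * y) g⁻¹, e4, h.inv, dd_symm h (g * y) y] at i5
  rw [dd_symm h v (g * y)] at i2
  have t1 := h.mul g y
  have t2 := h.mul g⁻¹ (g * y)
  rw [inv_mul_cancel_left, h.inv] at t2
  have t3 := h.mul g v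
  have t4 := h.mul g⁻¹ (g * v)
  rw [inv_mul_cancel_left, h.inv] at t4
  have t5 := dd_tri h y (g * y) v
  have t6 : dd l y v ≤ dd l (g * y) v + l g := by
    have := dd_tri h (g * y) v (g * v)
    rw [dd_left, e3] at this; exact this
  have t7 : dd l (g * y) v ≤ dd l y v + l g := by
    have := dd_tri h (g * y) (g * v) v
    rw [dd_left, e3'] at this; exact this
  have t8 := dd_tri h 1 (g ^ 2 * y) y
  have t9 := dd_tri h 1 y (g ^ 2 * y)
  rw [dd_one_left, dd_one_left] at t8 t9
  rw [dd_symm h (g ^ 2 * y) y] at t8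
  have j1 : dd l y v + l (g * y) ≤ l (g * v) + 2 * δ := by
    rcases i1 with i | i <;> linarith
  have j2 : l (g * v) + dd l (g * y) v ≤ l v + dd l y v + 2 * δ := by
    rcases i2 with i | i <;> linarith
  have j3 : dd l y (g * y) ≤ |l (g * y) - l y| + 6 * δ := by
    have a1 := le_abs_self (l (g * y) - l y)
    have a2 := neg_abs_le (l (g * y) - l y)
    rcases i3 with i | i <;> linarith
  have j4 : |l (g * y) - l y| ≤ l g := by rw [abs_le]; constructor <;> linarith
  have j5 : l y + l (g ^ 2 * y) ≤ l (g * y) + l (g * y) + 2 * δ := by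
    rcases i4 with i | i <;> linarith
  have j6 : l (g * y) + l (g * y) ≤ l y + l (g ^ 2 * y) + 2 * δ := by
    rcases i5 with i | i <;> linarith
  rcases abs_cases (l (g * y) - l y) with ⟨e, _⟩ | ⟨e, _⟩ <;> rw [e] at j3 <;> linarith

theorem exists_super (h : HypLen l δ) (g : Γ) (hg : ¬ IsOfFinOrder g) :
    ∃ C, ∀ m n : ℕ, l (g ^ m) + l (g ^ n) ≤ l (g ^ (m + n)) + C := by
  by_contra hc
  have hδ := h.del
  have gn := h.nonneg g
  have hno : ∀ i : ℕ, 0 < i → ∀ y, dd l y ((g ^ i) ^ 2 * y) < dd l y (g ^ i * y) + (3 * δ + 1) := by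
    intro i hi y
    by_contra hcc
    push Not at hcc
    exact hc (root_super h g i hi (lox_super h (g ^ i) y hcc))
  set M := (h.fin (17 * δ + 1)).toFinset.card with hM
  obtain ⟨N, hN⟩ := exists_large h g hg (2 * (10 * (M * l g) + 20 * δ) + 1)
  obtain ⟨y, hy1, hy2⟩ := h.mid (g ^ N)
  rw [abs_le] at hy2
  have small : ∀ i ∈ Finset.range (M + 1), y⁻¹ * (g ^ i * y) ∈ (h.fin (17 * δ + 1)).toFinset := by
    intro i hi
    rw [Set.Finite.mem_toFinset]
    show dd l y (g ^ i * y) ≤ _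
    rcases Nat.eq_zero_or_pos i with rfl | hi0
    · simp [dd, h.one]; linarith
    · have hl := len_pow_le h g i
      have hiM : (i : ℝ) * l g ≤ M * l g := by
        apply mul_le_mul_of_nonneg_right _ gn
        have := Finset.mem_range.1 hi
        exact_mod_cast (by omega : i ≤ M)
      refine small_disp h (g ^ i) (g ^ N) y (pow_mul_comm _ _ _) hy1 ?_ ?_ (hno i hi0 y)
      · linarith [hy2.1, hy2.2]
      · show _ < l (y⁻¹ * g ^ N)
        linarith [hy2.1, hy2.2]
  obtain ⟨i, _, j, _, hij, he⟩ := Finset.exists_ne_map_eq_of_card_lt_of_maps_to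
    (by rw [Finset.card_range]; omega) small
  have inj := (injective_pow_iff_not_isOfFinOrder (x := g)).2 hg
  exact hij (inj (by simpa using he))

end geom
section elem
variable {Γ : Type} [Group Γ] {l : Γ → ℝ} {δ : ℝ}

/-- Gromov product at the identity -/
noncomputable def gpl (l : Γ → ℝ) (x y : Γ) : ℝ := (l x + l y - dd l x y) / 2

theorem disc_ivt (f : ℕ → ℝ) (t c : ℝ) (hc : 0 ≤ c) (N : ℕ) (h0 : f 0 ≤ t) (hN : t ≤ f N)
    (hstep : ∀ i, f (i + 1) ≤ f i + c) : ∃ i ≤ N, t ≤ f i ∧ f i ≤ t + c := by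
  classical
  have hex : ∃ i, t ≤ f i := ⟨N, hN⟩
  refine ⟨Nat.find hex, Nat.find_min' hex hN, Nat.find_spec hex, ?_⟩
  rcases hn : Nat.find hex with _ | i
  · linarith
  · have := Nat.find_min hex (m := i) (by omega)
    push Not at this
    linarith [hstep i]

theorem fellow (h : HypLen l δ) (g1 g2 k : Γ) (C c t : ℝ)
    (s1 : ∀ m n : ℕ, l (g1 ^ m) + l (g1 ^ n) ≤ l (g1 ^ (m + n)) + C)
    (s2 : ∀ m n : ℕ, l (g2 ^ m) + l (g2 ^ n) ≤ l (g2 ^ (m + n)) + C)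
    (c1 : l g1 ≤ c) (c2 : l g2 ≤ c) (ht : l k + C + δ + 1 ≤ t) (N M : ℕ)
    (hNM : t + c < gpl l (g1 ^ N) (k * g2 ^ M)) :
    ∃ i j : ℕ, t ≤ l (g1 ^ j) ∧ dd l (g1 ^ j) (k * g2 ^ i) ≤ c + C + 4 * δ := by
  have hδ := h.del
  have hc : 0 ≤ c := (h.nonneg g1).trans c1
  have hC : 0 ≤ C := by have := s1 0 0; simp [h.one] at this; exact this
  have hk := h.nonneg k
  unfold gpl at hNM
  have u1 := dd_tri h 1 (g1 ^ N) (k * g2 ^ M)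
  have u2 := dd_tri h 1 (k * g2 ^ M) (g1 ^ N)
  rw [dd_one_left, dd_one_left] at u1 u2
  rw [dd_symm h (k * g2 ^ M) (g1 ^ N)] at u2
  obtain ⟨j, hj, hj1, hj2⟩ := disc_ivt (fun j => l (g1 ^ j)) t c hc N
    (by simp [h.one]; linarith) (by show t ≤ l (g1 ^ N); linarith)
    (fun i => by have := h.mul (g1 ^ i) g1; show l (g1 ^ (i+1)) ≤ l (g1 ^ i) + c; rw [pow_succ]; linarith)
  obtain ⟨i, hi, hi1, hi2⟩ := disc_ivt (fun j => l (k * g2 ^ j)) t c hc M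
    (by simp; linarith) (by show t ≤ l (k * g2 ^ M); linarith)
    (fun i => by
      have := h.mul (k * g2 ^ i) g2
      show l (k * g2 ^ (i+1)) ≤ l (k * g2 ^ i) + c
      rw [pow_succ, ← mul_assoc]; linarith)
  refine ⟨i, j, hj1, ?_⟩
  have A1 : l (g1 ^ j) + dd l (g1 ^ j) (g1 ^ N) ≤ l (g1 ^ N) + C := by
    obtain ⟨p, rfl⟩ := Nat.exists_eq_add_of_le hj
    have := s1 j p
    simpa [dd, pow_add] using this
  have A2 : dd l k (k * g2 ^ i) + dd l (k * g2 ^ i) (k * g2 ^ M) ≤ dd l k (k * g2 ^ M) + C := by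
    obtain ⟨p, rfl⟩ := Nat.exists_eq_add_of_le hi
    have := s2 i p
    simpa [dd, pow_add] using this
  have A3 := dd_tri h 1 k (k * g2 ^ i)
  have q1 := dd_four h k (k * g2 ^ M) 1 (k * g2 ^ i)
  have q2 := dd_four h (g1 ^ j) (k * g2 ^ M) (g1 ^ N) 1
  have q3 := dd_four h (g1 ^ j) (k * g2 ^ i) (k * g2 ^ M) 1
  simp only [dd_one_left, dd_one_right h] at A3 q1 q2 q3
  rw [dd_symm h (k * g2 ^ M) (k * g2 ^ i)] at q1
  rw [dd_symm h (k * g2 ^ M) (g1 ^ N)] at q2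
  have A4 : l (k * g2 ^ i) + dd l (k * g2 ^ i) (k * g2 ^ M) ≤ l (k * g2 ^ M) + C + 2 * δ := by
    rcases q1 with q | q <;> linarith
  have A5 : dd l (g1 ^ j) (k * g2 ^ M) ≤ l (k * g2 ^ M) - l (g1 ^ j) + C + 2 * δ := by
    rcases q2 with q | q <;> linarith
  rcases q3 with q | q <;> linarith

theorem exists_indep (h : HypLen l δ) (g : Γ) (hg : ¬ IsOfFinOrder g) (C : ℝ)
    (hC : ∀ m n : ℕ, l (g ^ m) + l (g ^ n) ≤ l (g ^ (m + n)) + C)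
    (hidx : (Subgroup.zpowers g).index = 0) :
    ∃ k R, ∀ n m : ℤ, gpl l (g ^ n) (k * g ^ m) ≤ R := by
  classical
  by_contra hcon
  push Not at hcon
  set C0 := l g + C + 4 * δ with hC0
  have sgn : ∀ n : ℤ, ∃ g1 : Γ, ∃ N : ℕ, g1 ^ N = g ^ n ∧ (∀ m : ℕ, ∃ z : ℤ, g1 ^ m = g ^ z) ∧
      l g1 ≤ l g ∧ ∀ m n : ℕ, l (g1 ^ m) + l (g1 ^ n) ≤ l (g1 ^ (m + n)) + C := by
    intro n
    rcases Int.eq_nat_or_neg n with ⟨N, rfl | rfl⟩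
    · exact ⟨g, N, by simp, fun m => ⟨m, by simp⟩, le_rfl, hC⟩
    · refine ⟨g⁻¹, N, by simp, fun m => ⟨-m, by simp⟩, (h.inv g).le, fun m n => ?_⟩
      simp only [inv_pow, h.inv]; exact hC m n
  have near : ∀ k : Γ, ∀ t : ℝ, ∃ n m : ℤ, t ≤ l (g ^ n) ∧ dd l (g ^ n) (k * g ^ m) ≤ C0 := by
    intro k t
    obtain ⟨n, m, hnm⟩ := hcon k (max t (l k + C + δ + 1) + l g)
    obtain ⟨g1, N, e1, z1, l1, s1⟩ := sgn n
    obtain ⟨g2, M, e2, z2, l2, s2⟩ := sgn m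
    rw [← e1, ← e2] at hnm
    obtain ⟨i, j, hj, hd⟩ := fellow h g1 g2 k C (l g) _ s1 s2 l1 l2 (le_max_right _ _) N M hnm
    obtain ⟨n', hn'⟩ := z1 j
    obtain ⟨m', hm'⟩ := z2 i
    exact ⟨n', m', hn' ▸ (le_max_left _ _).trans hj, by rw [← hn', ← hm']; exact hd⟩
  have inf : ∀ k : Γ, {n : ℤ | ∃ m : ℤ, dd l (g ^ n) (k * g ^ m) ≤ C0}.Infinite := by
    intro k hfin
    obtain ⟨b, hb⟩ := (hfin.image (fun n => l (g ^ n))).bddAbove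
    obtain ⟨n, m, h1, h2⟩ := near k (b + 1)
    have := hb ⟨n, ⟨m, h2⟩, rfl⟩
    simp only at this
    linarith
  have rep : ∀ k : Γ, ∃ b : Γ, l b ≤ C0 ∧ ∃ n m : ℤ, k = g ^ n * b * g ^ m ∧
      ∃ p : ℕ, 0 < p ∧ ∃ q : ℤ, g ^ p = b * g ^ q * b⁻¹ := by
    intro k
    have : ∀ n : ℤ, ∃ m : ℤ, (∃ m : ℤ, dd l (g ^ n) (k * g ^ m) ≤ C0) → dd l (g ^ n) (k * g ^ m) ≤ C0 := by
      intro n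
      by_cases hx : ∃ m : ℤ, dd l (g ^ n) (k * g ^ m) ≤ C0
      · exact ⟨hx.choose, fun _ => hx.choose_spec⟩
      · exact ⟨0, fun h => absurd h hx⟩
    choose mm hmm using this
    obtain ⟨n1, hn1, n2, hn2, hne, he⟩ := (inf k).exists_ne_map_eq_of_mapsTo
      (f := fun n => (g ^ n)⁻¹ * (k * g ^ (mm n))) (t := {x | l x ≤ C0})
      (fun n hn => hmm n hn) (h.fin C0)
    wlog hlt : n1 < n2 generalizing n1 n2
    · exact this n2 hn2 n1 hn1 hne.symm he.symm (lt_of_le_of_ne (not_lt.1 hlt) hne.symm)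
    refine ⟨(g ^ n1)⁻¹ * (k * g ^ (mm n1)), hmm n1 hn1, n1, - mm n1, by group, (n2 - n1).toNat,
      by omega, mm n2 - mm n1, ?_⟩
    have e0 : g ^ (n2 - n1).toNat = g ^ (n2 - n1) := by
      rw [← zpow_natCast]; congr 1; omega
    rw [e0]
    have e1 : k * g ^ mm n2 = g ^ n2 * ((g ^ n1)⁻¹ * (k * g ^ (mm n1))) := by rw [he]; group
    calc g ^ (n2 - n1) = g ^ n2 * (g ^ n1)⁻¹ := by rw [zpow_sub]
      _ = (g ^ n1)⁻¹ * (g ^ n2 * ((g ^ n1)⁻¹ * (k * g ^ (mm n1)))) * ((g ^ n1)⁻¹ * (k * g ^ (mm n1)))⁻¹ * g ^ n1 * (g ^ n1)⁻¹ := by group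
      _ = (g ^ n1)⁻¹ * (k * g ^ mm n2) * ((g ^ n1)⁻¹ * (k * g ^ (mm n1)))⁻¹ := by rw [← e1]; group
      _ = _ := by group
  have hP : ∀ b : Γ, ∃ p : ℕ, (∃ p : ℕ, 0 < p ∧ ∃ q : ℤ, g ^ p = b * g ^ q * b⁻¹) →
      0 < p ∧ ∃ q : ℤ, g ^ p = b * g ^ q * b⁻¹ := by
    intro b
    by_cases hx : ∃ p : ℕ, 0 < p ∧ ∃ q : ℤ, g ^ p = b * g ^ q * b⁻¹
    · exact ⟨hx.choose, fun _ => hx.choose_spec⟩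
    · exact ⟨0, fun h => absurd h hx⟩
  choose P hP using hP
  have hfin : (Set.univ : Set (Γ ⧸ Subgroup.zpowers g)).Finite := by
    refine ((h.fin C0).biUnion (fun b _ => (Set.finite_Iio (P b)).image
      (fun r : ℕ => (QuotientGroup.mk (g ^ r * b) : Γ ⧸ Subgroup.zpowers g)))).subset ?_
    intro x _
    obtain ⟨k, rfl⟩ := QuotientGroup.mk_surjective x
    obtain ⟨b, hb, n, m, hk, hp⟩ := rep k
    obtain ⟨p0, q, hq⟩ := hP b hp
    refine Set.mem_biUnion (show b ∈ {x | l x ≤ C0} from hb) ?_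
    have hp0 : (0 : ℤ) < P b := by exact_mod_cast p0
    have m0 := Int.emod_nonneg n hp0.ne'
    have m1 := Int.emod_lt_of_pos n hp0
    refine ⟨(n % (P b : ℤ)).toNat, by simp only [Set.mem_Iio]; omega, ?_⟩
    rw [QuotientGroup.eq, Subgroup.mem_zpowers_iff]
    refine ⟨q * (n / P b) + m, ?_⟩
    have e1 : g ^ (n % (P b : ℤ)).toNat = g ^ (n % (P b : ℤ)) := by
      rw [← zpow_natCast]; congr 1; omega
    have e2 : g ^ n = g ^ (n % (P b : ℤ)) * (b * g ^ q * b⁻¹) ^ (n / P b) := by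
      rw [← hq, ← zpow_natCast, ← zpow_mul, ← zpow_add, Int.emod_add_mul_ediv]
    rw [hk, e1, e2, conj_zpow, zpow_add, zpow_mul]
    group
  have : Finite (Γ ⧸ Subgroup.zpowers g) := Set.finite_univ_iff.1 hfin
  exact Subgroup.index_ne_zero_of_finite hidx

theorem exists_paradox (h : HypLen l δ) (g : Γ) (hg : ¬ IsOfFinOrder g) (C : ℝ)
    (hC : ∀ m n : ℕ, l (g ^ m) + l (g ^ n) ≤ l (g ^ (m + n)) + C)
    (hidx : (Subgroup.zpowers g).index = 0) :
    ∃ (D : Set Γ) (a b k : Γ), (∀ x, x ∈ D ∨ k⁻¹ * x ∈ D) ∧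
      (∀ x, ¬ (x ∈ D ∧ a⁻¹ * x ∈ D)) ∧ (∀ x, ¬ (x ∈ D ∧ b⁻¹ * x ∈ D)) ∧
      (∀ x, ¬ (a⁻¹ * x ∈ D ∧ b⁻¹ * x ∈ D)) := by
  have hδ := h.del
  obtain ⟨k, R, hkR⟩ := exists_indep h g hg C hC hidx
  set R0 := R + l k + δ with hR0
  obtain ⟨p, hp⟩ := exists_large h g hg (2 * R0 + C)
  have hC0 : 0 ≤ C := by have := hC 0 0; simp [h.one] at this; exact this
  have key : ∀ (N : ℕ) (x : Γ), 2 * R0 < l (g ^ N) → x ∈ {x | ∀ n : ℤ, gpl l x (g ^ n) ≤ R0} →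
      (g ^ N)⁻¹ * x ∈ {x | ∀ n : ℤ, gpl l x (g ^ n) ≤ R0} → False := by
    intro N x hN h1 h2
    have a1 := h1 N
    have a2 := h2 (-N)
    simp only [gpl, zpow_neg, zpow_natCast, h.inv] at a1 a2
    have e : dd l ((g ^ N)⁻¹ * x) (g ^ N)⁻¹ = l x := by simp [dd, h.inv]
    have e2 : l ((g ^ N)⁻¹ * x) = dd l x (g ^ N) := by rw [dd_symm h]; rfl
    rw [e, e2] at a2
    linarith
  have hp2 := hC p p
  have hpn := h.nonneg (g ^ p)
  refine ⟨{x | ∀ n : ℤ, gpl l x (g ^ n) ≤ R0}, g ^ p, g ^ (p + p), k, ?_, ?_, ?_, ?_⟩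
  · intro x
    by_contra hx
    rw [not_or] at hx
    obtain ⟨h1, h2⟩ := hx
    simp only [Set.mem_ofPred_eq, not_forall, not_le] at h1 h2
    obtain ⟨n, hn⟩ := h1
    obtain ⟨m, hm⟩ := h2
    have := hkR n m
    have q := dd_four h (g ^ n) (k * g ^ m) x 1
    have e1 : dd l (k⁻¹ * x) (g ^ m) = dd l x (k * g ^ m) := by
      rw [← dd_left (l := l) k]; congr 1; group
    have t1 := h.mul k⁻¹ x
    have t2 := h.mul k⁻¹ (k * g ^ m)
    rw [inv_mul_cancel_left, h.inv] at t2
    rw [h.inv] at t1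
    have hk0 := h.nonneg k
    simp only [gpl, e1, dd_one_right h] at hn hm this q
    rw [dd_symm h (g ^ n) x, dd_symm h (k * g ^ m) x] at q
    rcases q with q | q <;> linarith
  · rintro x ⟨h1, h2⟩
    exact key p x (by linarith) h1 h2
  · rintro x ⟨h1, h2⟩
    exact key (p + p) x (by linarith) h1 h2
  · rintro x ⟨h1, h2⟩
    refine key p _ (by linarith) h1 ?_
    rwa [pow_add, mul_inv_rev, mul_assoc] at h2

end elem
section gap
variable {Γ : Type} [Group Γ]

/-- squared difference energy -/
noncomputable def en (f : Γ → ℝ) (t : Γ) : ℝ := ∑' x, (f (t * x) - f x) ^ 2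

theorem summable_trans {f : Γ → ℝ} (hf : Summable fun x => f x ^ 2) (t : Γ) :
    Summable fun x => f (t * x) ^ 2 :=
  (Equiv.mulLeft t).summable_iff (f := fun x => f x ^ 2) |>.2 hf

theorem tsum_trans (F : Γ → ℝ) (t : Γ) : ∑' x, F (t * x) = ∑' x, F x :=
  (Equiv.mulLeft t).tsum_eq F

theorem summable_diff {f : Γ → ℝ} (hf : Summable fun x => f x ^ 2) (t s : Γ) :
    Summable fun x => (f (t * x) - f (s * x)) ^ 2 := by
  refine Summable.of_nonneg_of_le (fun x => sq_nonneg _) (fun x => ?_)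
    (((summable_trans hf t).mul_left 2).add ((summable_trans hf s).mul_left 2))
  nlinarith [sq_nonneg (f (t * x) + f (s * x))]

theorem summable_diff1 {f : Γ → ℝ} (hf : Summable fun x => f x ^ 2) (t : Γ) :
    Summable fun x => (f (t * x) - f x) ^ 2 := by
  simpa using summable_diff hf t 1

theorem summable_prod {f : Γ → ℝ} (hf : Summable fun x => f x ^ 2) (t : Γ) :
    Summable fun x => f (t * x) * f x := by
  have h := (((summable_trans hf t).add hf).sub (summable_diff1 hf t)).mul_left (1/2)
  refine h.congr (fun x => ?_)
  ring

theorem en_eq {f : Γ → ℝ} (hf : Summable fun x => f x ^ 2) (t : Γ) :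
    en f t = 2 * ∑' x, f x ^ 2 - 2 * ∑' x, f (t * x) * f x := by
  have h1 : ∀ x, (f (t * x) - f x) ^ 2 = (f (t * x) ^ 2 + f x ^ 2) - 2 * (f (t * x) * f x) :=
    fun x => by ring
  unfold en
  rw [tsum_congr h1, ((summable_trans hf t).add hf).tsum_sub ((summable_prod hf t).mul_left 2),
    (summable_trans hf t).tsum_add hf, tsum_mul_left, tsum_trans (fun x => f x ^ 2) t]
  ring

theorem en_nonneg (f : Γ → ℝ) (t : Γ) : 0 ≤ en f t := tsum_nonneg fun _ => sq_nonneg _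

theorem gap_paradox (D : Set Γ) (a b k : Γ) (hk : ∀ x, x ∈ D ∨ k⁻¹ * x ∈ D)
    (h1 : ∀ x, ¬ (x ∈ D ∧ a⁻¹ * x ∈ D)) (h2 : ∀ x, ¬ (x ∈ D ∧ b⁻¹ * x ∈ D))
    (h3 : ∀ x, ¬ (a⁻¹ * x ∈ D ∧ b⁻¹ * x ∈ D)) (f : Γ → ℝ) (hf : Summable fun x => f x ^ 2) :
    ∑' x, f x ^ 2 ≤ 40 * (en f a + en f b + en f k) := by
  classical
  set c : Γ → ℝ := fun x => if x ∈ D then 1 else 0 with hc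
  have c0 : ∀ x, 0 ≤ c x := fun x => by simp only [hc]; split_ifs <;> norm_num
  have c1 : ∀ x, c x ≤ 1 := fun x => by simp only [hc]; split_ifs <;> norm_num
  have sm : ∀ t : Γ, Summable fun x => c x * f (t * x) ^ 2 := fun t =>
    Summable.of_nonneg_of_le (fun x => mul_nonneg (c0 x) (sq_nonneg _))
      (fun x => mul_le_of_le_one_left (sq_nonneg _) (c1 x)) (summable_trans hf t)
  have sm0 : Summable fun x => c x * f x ^ 2 := by simpa using sm 1
  have smt : ∀ t : Γ, Summable fun x => c (t⁻¹ * x) * f x ^ 2 := fun t =>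
    Summable.of_nonneg_of_le (fun x => mul_nonneg (c0 _) (sq_nonneg _))
      (fun x => mul_le_of_le_one_left (sq_nonneg _) (c1 _)) hf
  have X : ∀ t : Γ, ∑' x, c (t⁻¹ * x) * f x ^ 2 = ∑' x, c x * f (t * x) ^ 2 := fun t => by
    rw [← tsum_trans _ t]; simp
  have A1 : ∑' x, f x ^ 2 ≤ ∑' x, c x * f x ^ 2 + ∑' x, c x * f (k * x) ^ 2 := by
    rw [← X k, ← sm0.tsum_add (smt k)]
    refine hf.tsum_le_tsum (fun x => ?_) (sm0.add (smt k))
    rw [← add_mul]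
    refine le_mul_of_one_le_left (sq_nonneg _) ?_
    rcases hk x with h | h
    · have : c x = 1 := by simp [hc, h]
      linarith [c0 (k⁻¹ * x)]
    · have : c (k⁻¹ * x) = 1 := by simp [hc, h]
      linarith [c0 x]
  have A2 : ∑' x, c x * f x ^ 2 + ∑' x, c x * f (a * x) ^ 2 + ∑' x, c x * f (b * x) ^ 2
      ≤ ∑' x, f x ^ 2 := by
    rw [← X a, ← X b, ← sm0.tsum_add (smt a), ← (sm0.add (smt a)).tsum_add (smt b)]
    refine ((sm0.add (smt a)).add (smt b)).tsum_le_tsum (fun x => ?_) hf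
    rw [← add_mul, ← add_mul]
    refine mul_le_of_le_one_left (sq_nonneg _) ?_
    have := h1 x
    have := h2 x
    have := h3 x
    simp only [hc]
    split_ifs <;> first | tauto | norm_num
  have pw : ∀ u v w : ℝ, 0 ≤ w → w ≤ 1 → w * u ^ 2 ≤ 9 / 8 * (w * v ^ 2) + 9 * (u - v) ^ 2 := by
    intro u v w w0 w1
    have e1 : u ^ 2 ≤ 9 / 8 * v ^ 2 + 9 * (u - v) ^ 2 := by nlinarith [sq_nonneg (8 * u - 9 * v)]
    have e2 := mul_le_mul_of_nonneg_left e1 w0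
    have e3 := mul_le_of_le_one_left (sq_nonneg (u - v)) w1
    nlinarith
  have A3 : ∑' x, c x * f (k * x) ^ 2 ≤ 9 / 8 * ∑' x, c x * f x ^ 2 + 9 * en f k := by
    unfold en
    rw [← tsum_mul_left, ← tsum_mul_left, ← (sm0.mul_left _).tsum_add ((summable_diff1 hf k).mul_left _)]
    exact (sm k).tsum_le_tsum (fun x => pw _ _ _ (c0 x) (c1 x))
      ((sm0.mul_left _).add ((summable_diff1 hf k).mul_left _))
  have A4 : ∀ t, ∑' x, c x * f x ^ 2 ≤ 9 / 8 * ∑' x, c x * f (t * x) ^ 2 + 9 * en f t := by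
    intro t
    unfold en
    rw [← tsum_mul_left, ← tsum_mul_left,
      ← ((sm t).mul_left _).tsum_add ((summable_diff1 hf t).mul_left _)]
    refine sm0.tsum_le_tsum (fun x => ?_)
      (((sm t).mul_left _).add ((summable_diff1 hf t).mul_left _))
    have := pw (f x) (f (t * x)) _ (c0 x) (c1 x)
    rw [sub_sq_comm] at this
    exact this
  have := A4 a
  have := A4 b
  have := en_nonneg f a
  have := en_nonneg f b
  have := en_nonneg f k
  linarith

theorem en_word (μ : Γ → ℝ) (Sf : Finset Γ) (h0 : ∀ g, 0 ≤ μ g) (hSf : ∀ g, μ g ≠ 0 → g ∈ Sf)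
    (w : List Γ) (hw : ∀ x ∈ w, 0 < μ x) :
    ∃ A : ℝ, 0 ≤ A ∧ ∀ f : Γ → ℝ, Summable (fun x => f x ^ 2) →
      en f w.prod ≤ A * ∑ s ∈ Sf, μ s * en f s := by
  induction w with
  | nil => exact ⟨0, le_rfl, fun f _ => by simp [en]⟩
  | cons s w ih =>
    obtain ⟨A, hA, h⟩ := ih (fun x hx => hw x (List.mem_cons_of_mem _ hx))
    have hs : 0 < μ s := hw s List.mem_cons_self
    refine ⟨2 / μ s + 2 * A, by positivity, fun f hf => ?_⟩
    have e1 : en f (s * w.prod) ≤ 2 * en f s + 2 * en f w.prod := by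
      have hsh : Summable fun x => (f (s * (w.prod * x)) - f (w.prod * x)) ^ 2 := by
        simpa [mul_assoc] using summable_diff hf (s * w.prod) w.prod
      have e : en f s = ∑' x, (f (s * (w.prod * x)) - f (w.prod * x)) ^ 2 :=
        (tsum_trans (fun x => (f (s * x) - f x) ^ 2) w.prod).symm
      rw [e]
      unfold en
      rw [← tsum_mul_left, ← tsum_mul_left,
        ← (hsh.mul_left 2).tsum_add ((summable_diff1 hf w.prod).mul_left 2)]
      refine (summable_diff1 hf (s * w.prod)).tsum_le_tsum (fun x => ?_)
        ((hsh.mul_left 2).add ((summable_diff1 hf w.prod).mul_left 2))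
      rw [mul_assoc]
      nlinarith [sq_nonneg ((f (s * (w.prod * x)) - f (w.prod * x)) - (f (w.prod * x) - f x))]
    have e2 : μ s * en f s ≤ ∑ s ∈ Sf, μ s * en f s :=
      Finset.single_le_sum (f := fun s => μ s * en f s)
        (fun i _ => mul_nonneg (h0 i) (en_nonneg f i)) (hSf s hs.ne')
    have e3 : en f s ≤ (1 / μ s) * ∑ s ∈ Sf, μ s * en f s := by
      rw [one_div, ← div_eq_inv_mul, le_div_iff₀ hs]; linarith
    have e4 := h f hf
    rw [List.prod_cons]
    calc _ ≤ _ := e1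
      _ ≤ 2 * ((1 / μ s) * ∑ s ∈ Sf, μ s * en f s) + 2 * (A * ∑ s ∈ Sf, μ s * en f s) := by linarith
      _ = _ := by ring

theorem gap_energy (μ : Γ → ℝ) (Sf : Finset Γ) (h0 : ∀ g, 0 ≤ μ g) (hSf : ∀ g, μ g ≠ 0 → g ∈ Sf)
    (hnd : ∀ g : Γ, ∃ l : List Γ, l ≠ [] ∧ (∀ x ∈ l, 0 < μ x) ∧ l.prod = g)
    (D : Set Γ) (a b k : Γ) (hk : ∀ x, x ∈ D ∨ k⁻¹ * x ∈ D)
    (h1 : ∀ x, ¬ (x ∈ D ∧ a⁻¹ * x ∈ D)) (h2 : ∀ x, ¬ (x ∈ D ∧ b⁻¹ * x ∈ D))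
    (h3 : ∀ x, ¬ (a⁻¹ * x ∈ D ∧ b⁻¹ * x ∈ D)) :
    ∃ κ : ℝ, 0 < κ ∧ ∀ f : Γ → ℝ, Summable (fun x => f x ^ 2) →
      κ * ∑' x, f x ^ 2 ≤ ∑ s ∈ Sf, μ s * en f s := by
  have hh : ∀ g : Γ, ∃ A : ℝ, 0 ≤ A ∧ ∀ f : Γ → ℝ, Summable (fun x => f x ^ 2) →
      en f g ≤ A * ∑ s ∈ Sf, μ s * en f s := by
    intro g
    obtain ⟨w, _, hw, rfl⟩ := hnd g
    exact en_word μ Sf h0 hSf w hw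
  obtain ⟨A, hA, ha⟩ := hh a
  obtain ⟨B, hB, hb⟩ := hh b
  obtain ⟨C, hC, hc⟩ := hh k
  refine ⟨(40 * (A + B + C) + 1)⁻¹, by positivity, fun f hf => ?_⟩
  have := gap_paradox D a b k hk h1 h2 h3 f hf
  have e1 := ha f hf
  have e2 := hb f hf
  have e3 := hc f hf
  have e4 : 0 ≤ ∑ s ∈ Sf, μ s * en f s :=
    Finset.sum_nonneg (fun i _ => mul_nonneg (h0 i) (en_nonneg f i))
  rw [inv_mul_le_iff₀ (by positivity)]
  nlinarith

theorem bound_of_sub (μ : Γ → ℝ) (Sf : Finset Γ) (htot : ∑ s ∈ Sf, μ s = 1) (κ : ℝ) (hκ : 0 < κ)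
    (hgap : ∀ f : Γ → ℝ, Summable (fun x => f x ^ 2) →
      κ * ∑' x, f x ^ 2 ≤ ∑ s ∈ Sf, μ s * en f s)
    (u : Γ → ℝ) (hu0 : ∀ x, 0 ≤ u x) (hu : Summable fun x => u x ^ 2)
    (hsub : ∀ x, u x ≤ (open Classical in if x = 1 then (1 : ℝ) else 0) +
      (1 + κ / 4) * ∑ s ∈ Sf, μ s * u (s * x)) (x : Γ) : u x ≤ 4 / κ := by
  classical
  set Q := ∑' x, u x ^ 2 with hQ
  have hQ0 : 0 ≤ Q := tsum_nonneg fun _ => sq_nonneg _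
  have le : ∀ x, u x ^ 2 ≤ Q := fun x => hu.le_tsum x (fun _ _ => sq_nonneg _)
  have H1 : HasSum (fun x => (if x = 1 then u 1 else 0) +
      (1 + κ / 4) * ∑ s ∈ Sf, μ s * (u (s * x) * u x))
      (u 1 + (1 + κ / 4) * ∑ s ∈ Sf, μ s * ∑' x, u (s * x) * u x) :=
    (hasSum_ite_eq 1 (u 1)).add ((hasSum_sum fun s _ =>
      ((summable_prod hu s).hasSum.mul_left (μ s))).mul_left _)
  have H2 : Q ≤ u 1 + (1 + κ / 4) * ∑ s ∈ Sf, μ s * ∑' x, u (s * x) * u x := by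
    refine hasSum_le (fun x => ?_) hu.hasSum H1
    have := mul_le_mul_of_nonneg_right (hsub x) (hu0 x)
    rw [add_mul, mul_assoc, Finset.sum_mul] at this
    rw [pow_two]
    refine this.trans (add_le_add ?_ (le_of_eq ?_))
    · by_cases hx : x = 1
      · simp [hx]
      · simp [hx]
    · congr 1
      exact Finset.sum_congr rfl (fun s _ => by ring)
  have H3 : ∑ s ∈ Sf, μ s * en u s = 2 * Q - 2 * ∑ s ∈ Sf, μ s * ∑' x, u (s * x) * u x := by
    rw [Finset.sum_congr rfl (fun s _ => by rw [en_eq hu s])]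
    simp only [mul_sub]
    rw [Finset.sum_sub_distrib, ← Finset.sum_mul, htot, Finset.mul_sum]
    rw [one_mul]
    congr 1
    exact Finset.sum_congr rfl (fun s _ => by ring)
  have H4 := hgap u hu
  rw [H3] at H4
  have H5 : ∑ s ∈ Sf, μ s * ∑' x, u (s * x) * u x ≤ (1 - κ / 2) * Q := by linarith
  have H6 := mul_le_mul_of_nonneg_left H5 (by positivity : 0 ≤ 1 + κ / 4)
  have H7 : κ / 4 * Q ≤ u 1 := by
    have : 0 ≤ κ ^ 2 * Q := by positivity
    nlinarith
  have H8 : u 1 ≤ 4 / κ := by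
    rw [le_div_iff₀ hκ]
    by_contra hc
    push Not at hc
    have h1 := le 1
    have hu1 : 0 < u 1 := by
      rcases (hu0 1).lt_or_eq with h | h
      · exact h
      · rw [← h] at hc; norm_num at hc
    have h3 : κ / 4 * u 1 ^ 2 ≤ u 1 := (mul_le_mul_of_nonneg_left h1 (by positivity)).trans H7
    nlinarith
  have H9 : u x ^ 2 ≤ (4 / κ) ^ 2 := by
    refine (le x).trans ?_
    have : Q ≤ 4 / κ * u 1 := by
      rw [div_mul_eq_mul_div, le_div_iff₀ hκ]; linarith
    refine this.trans ?_
    rw [pow_two]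
    exact mul_le_mul_of_nonneg_left H8 (by positivity)
  exact le_of_sq_le_sq H9 (by positivity)

end gap
section walk
variable {Γ : Type} [Group Γ]

theorem ptrans_inv (μ : Γ → ℝ) (a : Γ) (n : ℕ) :
    ∀ x y, ptrans μ n (a * x) (a * y) = ptrans μ n x y := by
  induction n with
  | zero => intro x y; by_cases hxy : x = y <;> simp [ptrans, hxy]
  | succ n ih =>
    intro x y
    simp only [ptrans]
    rw [← tsum_trans _ a]
    refine tsum_congr fun z => ?_
    rw [ih]; congr 2; group

theorem green_inv (μ : Γ → ℝ) (a x y : Γ) : green μ (a * x) (a * y) = green μ x y := by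
  unfold green; exact tsum_congr fun n => ptrans_inv μ a n x y

theorem ptrans_nonneg (μ : Γ → ℝ) (h0 : ∀ g, 0 ≤ μ g) (n : ℕ) :
    ∀ x y, 0 ≤ ptrans μ n x y := by
  induction n with
  | zero => intro x y; simp only [ptrans]; split_ifs <;> norm_num
  | succ n ih => intro x y; exact tsum_nonneg fun z => mul_nonneg (ih _ _) (h0 _)

theorem ptrans_succ (μ : Γ → ℝ) (Sf : Finset Γ) (hSf : ∀ g, μ g ≠ 0 → g ∈ Sf) (n : ℕ) (x : Γ) :
    ptrans μ (n + 1) 1 x⁻¹ = ∑ s ∈ Sf, μ s * ptrans μ n 1 (s * x)⁻¹ := by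
  have e : ptrans μ (n + 1) 1 x⁻¹ = ∑' s, μ s * ptrans μ n 1 (s * x)⁻¹ := by
    simp only [ptrans]
    rw [← ((Equiv.mulRight x).trans (Equiv.inv Γ)).tsum_eq]
    refine tsum_congr fun s => ?_
    simp [mul_comm]
  rw [e, tsum_eq_sum]
  intro s hs
  have : μ s = 0 := by
    by_contra h
    exact hs (hSf s h)
  simp [this]

theorem ptrans_len {S : Set Γ} (hS : IsGenSet S) (μ : Γ → ℝ) (hμ : IsRWMeasure S μ) (n : ℕ) :
    ∀ x, ptrans μ n 1 x⁻¹ ≠ 0 → wl S x ≤ n := by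
  classical
  have hSf : ∀ g, μ g ≠ 0 → g ∈ hS.1.toFinset := fun g hg => by
    simpa using hμ.support_subset g hg
  induction n with
  | zero =>
    intro x hx
    have : x = 1 := by
      by_contra h
      apply hx
      simp only [ptrans]
      rw [if_neg]
      intro h'
      exact h (by simpa using h'.symm)
    rw [this, wl_one]
  | succ n ih =>
    intro x hx
    rw [ptrans_succ μ _ hSf] at hx
    obtain ⟨s, hs, hne⟩ := Finset.exists_ne_zero_of_sum_ne_zero hx
    have h1 := ih (s * x) (right_ne_zero_of_mul hne)
    have h2 := wl_mul hS s⁻¹ (s * x)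
    rw [inv_mul_cancel_left, wl_inv hS] at h2
    have h3 := wl_le (S := S) [s] (by simpa using hs)
    simp at h3
    omega

theorem ptrans_pos {S : Set Γ} (hS : IsGenSet S) (μ : Γ → ℝ) (hμ : IsRWMeasure S μ) (w : List Γ)
    (hw : ∀ x ∈ w, 0 < μ x) : 0 < ptrans μ w.length 1 w.prod := by
  classical
  have hSf : ∀ g, μ g ≠ 0 → g ∈ hS.1.toFinset := fun g hg => by
    simpa using hμ.support_subset g hg
  induction w using List.reverseRecOn with
  | nil => simp [ptrans]
  | append_singleton w s ih =>
    have h1 := ih (fun x hx => hw x (by simp [hx]))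
    have hs : 0 < μ s := hw s (by simp)
    have := ptrans_succ μ _ hSf w.length (w.prod * s)⁻¹
    rw [inv_inv] at this
    simp only [List.length_append, List.length_singleton, List.prod_append, List.prod_singleton]
    rw [this]
    refine lt_of_lt_of_le ?_ (Finset.single_le_sum
      (fun i _ => mul_nonneg (hμ.nonneg i) (ptrans_nonneg μ hμ.nonneg _ _ _)) (hSf s hs.ne'))
    have e : (s * (w.prod * s)⁻¹)⁻¹ = w.prod := by group
    rw [e]
    positivity

theorem green_decay {S : Set Γ} {δ : ℝ} (hS : IsGenSet S) (hδ : IsHyperbolic S δ)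
    (hne : Nonelementary Γ) (μ : Γ → ℝ) (hμ : IsRWMeasure S μ) (g : Γ) (hg : ¬ IsOfFinOrder g) :
    ∃ z A : ℝ, 1 < z ∧ ∀ y, 0 < green μ 1 y ∧ green μ 1 y * z ^ wl S y ≤ A := by
  classical
  have h := hypLen_wl hS hδ
  obtain ⟨C, hC⟩ := exists_super h g hg
  obtain ⟨D, a, b, k, d1, d2, d3, d4⟩ := exists_paradox h g hg C hC (hne g)
  set Sf := hS.1.toFinset with hSfd
  have hSf : ∀ g, μ g ≠ 0 → g ∈ Sf := fun g hg => by
    simpa [hSfd] using hμ.support_subset g hg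
  have htot : ∑ s ∈ Sf, μ s = 1 := by
    rw [← hμ.total, tsum_eq_sum]
    intro s hs
    by_contra h
    exact hs (hSf s h)
  obtain ⟨κ, hκ, hgap⟩ := gap_energy μ Sf hμ.nonneg hSf hμ.nondeg D a b k d1 d2 d3 d4
  set z := 1 + κ / 4 with hz
  have hz1 : 1 < z := by linarith
  have hz0 : 0 < z := by linarith
  set q : ℕ → Γ → ℝ := fun n x => ptrans μ n 1 x⁻¹ with hq
  have q0 : ∀ n x, 0 ≤ q n x := fun n x => ptrans_nonneg μ hμ.nonneg n _ _
  have qlen : ∀ n x, n < wl S x → q n x = 0 := by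
    intro n x hn
    by_contra hc
    exact absurd (ptrans_len hS μ hμ n x hc) (by omega)
  have bd : ∀ N x, ∑ n ∈ Finset.range N, z ^ n * q n x ≤ 4 / κ := by
    intro N x
    refine bound_of_sub μ Sf htot κ hκ hgap (fun x => ∑ n ∈ Finset.range N, z ^ n * q n x)
      (fun x => Finset.sum_nonneg fun n _ => mul_nonneg (by positivity) (q0 n x)) ?_ ?_ x
    · refine summable_of_hasFiniteSupport ?_
      refine (wl_ball hS N).subset ?_
      intro x hx
      by_contra hc
      have hc' : N < wl S x := not_le.1 hc
      apply hx
      have : ∑ n ∈ Finset.range N, z ^ n * q n x = 0 :=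
        Finset.sum_eq_zero fun n hn => by
          rw [qlen n x (by have := Finset.mem_range.1 hn; omega), mul_zero]
      simp [this]
    · intro x
      have e1 : ∑ n ∈ Finset.range N, z ^ n * q n x ≤ ∑ n ∈ Finset.range (N + 1), z ^ n * q n x := by
        rw [Finset.sum_range_succ]
        have := mul_nonneg (pow_nonneg hz0.le N) (q0 N x)
        linarith
      refine e1.trans (le_of_eq ?_)
      rw [Finset.sum_range_succ', add_comm]
      congr 1
      · simp only [hq, ptrans, pow_zero, one_mul]
        have : (1 = x⁻¹) ↔ x = 1 := by rw [eq_comm, inv_eq_one]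
        simp only [this]
      · simp only [Finset.mul_sum]
        rw [Finset.sum_comm]
        refine Finset.sum_congr rfl fun n _ => ?_
        simp only [hq]
        rw [ptrans_succ μ Sf hSf, Finset.mul_sum]
        refine Finset.sum_congr rfl fun s _ => ?_
        rw [pow_succ]; ring
  refine ⟨z, 4 / κ, hz1, fun y => ?_⟩
  have hn : ∀ n, 0 ≤ ptrans μ n 1 y := fun n => ptrans_nonneg μ hμ.nonneg n _ _
  have hqy : ∀ n, q n y⁻¹ = ptrans μ n 1 y := fun n => by simp [hq]
  have hb : ∀ N, ∑ n ∈ Finset.range N, ptrans μ n 1 y * z ^ wl S y ≤ 4 / κ := by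
    intro N
    refine le_trans (Finset.sum_le_sum fun n _ => ?_) (bd N y⁻¹)
    rw [mul_comm, hqy]
    by_cases hl : n < wl S y
    · have := qlen n y⁻¹ (by rwa [wl_inv hS])
      rw [hqy] at this
      rw [this]; simp
    · exact mul_le_mul_of_nonneg_right (pow_le_pow_right₀ hz1.le (by omega)) (hn n)
  have hnn : ∀ n, 0 ≤ ptrans μ n 1 y * z ^ wl S y := fun n => mul_nonneg (hn n) (by positivity)
  have hs := summable_of_sum_range_le hnn hb
  have hs' : Summable fun n => ptrans μ n 1 y :=
    (summable_mul_right_iff (pow_ne_zero _ hz0.ne')).1 hs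
  constructor
  · obtain ⟨w, _, hw, rfl⟩ := hμ.nondeg y
    exact hs'.tsum_pos hn w.length (ptrans_pos hS μ hμ w hw)
  · unfold green
    rw [← tsum_mul_right]
    exact Real.tsum_le_of_sum_range_le hnn hb

theorem convInf_pow {S : Set Γ} {δ : ℝ} (hS : IsGenSet S) (hδ : IsHyperbolic S δ)
    (g : Γ) (hg : ¬ IsOfFinOrder g) : ConvInf S (fun n : ℕ => g ^ n) := by
  have h := hypLen_wl hS hδ
  obtain ⟨C, hC⟩ := exists_super h g hg
  have main : ∀ n m : ℕ, n ≤ m → (wl S (g ^ n) : ℝ) - C ≤ gp S 1 (g ^ n) (g ^ m) := by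
    intro n m hnm
    obtain ⟨p, rfl⟩ := Nat.exists_eq_add_of_le hnm
    have := hC n p
    have c0 := hC 0 0
    simp [wl_one] at c0
    simp only [gp, wdist, mul_one, wl_inv hS]
    rw [show (g ^ n)⁻¹ * g ^ (n + p) = g ^ p by rw [pow_add]; group]
    linarith
  have symm : ∀ x y, gp S 1 x y = gp S 1 y x := by
    intro x y
    simp only [gp, wdist]
    rw [← wl_inv hS (x⁻¹ * y), mul_inv_rev, inv_inv]; ring
  refine tendsto_atTop.2 fun b => ?_
  obtain ⟨N, hN⟩ := exists_large h g hg (b + 2 * C)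
  have big : ∀ n, N ≤ n → b + C ≤ wl S (g ^ n) := by
    intro n hn
    obtain ⟨p, rfl⟩ := Nat.exists_eq_add_of_le hn
    have := hC N p
    have : (0 : ℝ) ≤ wl S (g ^ p) := by positivity
    linarith
  filter_upwards [eventually_ge_atTop ((N, N) : ℕ × ℕ)] with p hp
  rcases le_total p.1 p.2 with h1 | h1
  · have := main _ _ h1
    have := big p.1 hp.1
    linarith
  · have := main _ _ h1
    have := big p.2 hp.2
    rw [symm]
    linarith

end walk

theorem rfun_lt_one
    (Γ : Type) [Group Γ] (S : Set Γ) (δ : ℝ)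
    (hS : IsGenSet S) (hδ : IsHyperbolic S δ) (hne : Nonelementary Γ)
    (μ : Γ → ℝ) (hμ : IsRWMeasure S μ)
    (B : Boundary Γ S)
    (Kb : Γ → B.pt → ℝ)
    (hKb : ∀ (x : Γ) (ξ : B.pt) (u : ℕ → Γ), ConvInf S u → B.cls u = ξ →
      Tendsto (fun n => martinK μ x (u n)) atTop (𝓝 (Kb x ξ)))
    (g : Γ) (hg : ¬ IsOfFinOrder g) :
    rfun B Kb g < 1 := by
  have h := hypLen_wl hS hδ
  obtain ⟨C, hC⟩ := exists_super h g hg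
  obtain ⟨z, A, hz, hG⟩ := green_decay hS hδ hne μ hμ g hg
  have hr : rfun B Kb g = Kb g⁻¹ (plusPt B g) := by simp [rfun, hg]
  have hlim := hKb g⁻¹ (plusPt B g) (fun n => g ^ n) (convInf_pow hS hδ g hg) rfl
  rw [← hr] at hlim
  by_contra hlt
  push Not at hlt
  set a : ℕ → ℝ := fun n => green μ 1 (g ^ n) with ha
  have hK : ∀ n, martinK μ g⁻¹ (g ^ n) = a (n + 1) / a n := by
    intro n
    simp only [martinK, ha]
    rw [← green_inv μ g g⁻¹, mul_inv_cancel, pow_succ']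
  obtain ⟨p, hp⟩ := exists_large h g hg (C + 1)
  have lin : ∀ k : ℕ, k ≤ wl S (g ^ (p * k)) := by
    intro k
    induction k with
    | zero => simp
    | succ k ih =>
      have := hC (p * k) p
      rw [← Nat.mul_succ] at this
      have ih' : (k : ℝ) ≤ wl S (g ^ (p * k)) := by exact_mod_cast ih
      have : ((k + 1 : ℕ) : ℝ) ≤ wl S (g ^ (p * (k + 1))) := by
        push_cast
        simp only [Nat.succ_eq_add_one] at this hp
        linarith
      exact_mod_cast this
  have hp0 : 0 < p := by
    rcases Nat.eq_zero_or_pos p with rfl | h0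
    · have := lin 1
      simp [wl_one] at this
    · exact h0
  obtain ⟨θ, hθ0, hθ1, hθz⟩ : ∃ θ : ℝ, 0 < θ ∧ θ < 1 ∧ 1 < θ ^ p * z := by
    have c : Tendsto (fun θ : ℝ => θ ^ p * z) (𝓝[<] 1) (𝓝 (1 ^ p * z)) :=
      ((continuous_id.pow p).mul continuous_const).continuousWithinAt
    have e1 : ∀ᶠ θ : ℝ in 𝓝[<] 1, 1 < θ ^ p * z :=
      c.eventually (lt_mem_nhds (by simpa using hz))
    have e2 : ∀ᶠ θ : ℝ in 𝓝[<] 1, 0 < θ :=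
      eventually_nhdsWithin_of_eventually_nhds (lt_mem_nhds one_pos)
    have e3 : ∀ᶠ θ : ℝ in 𝓝[<] 1, θ < 1 := eventually_mem_nhdsWithin
    obtain ⟨θ, h1, h2, h3⟩ := (e1.and (e2.and e3)).exists
    exact ⟨θ, h2, h3, h1⟩
  have ev : ∀ᶠ n in atTop, θ < martinK μ g⁻¹ (g ^ n) :=
    hlim.eventually (lt_mem_nhds (hθ1.trans_le hlt))
  obtain ⟨N, hN⟩ := eventually_atTop.1 ev
  have step : ∀ n, N ≤ n → a n * θ ≤ a (n + 1) := by
    intro n hn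
    have := hN n hn
    rw [hK, lt_div_iff₀ (hG _).1] at this
    linarith
  have geo : ∀ m, a (p * N) * θ ^ m ≤ a (p * N + m) := by
    intro m
    induction m with
    | zero => simp
    | succ m ih =>
      have h1 := step (p * N + m) (by nlinarith)
      have h2 := mul_le_mul_of_nonneg_right ih hθ0.le
      rw [pow_succ, ← mul_assoc, ← add_assoc]
      linarith
  have fin : ∀ k : ℕ, a (p * N) * (θ ^ p * z) ^ k ≤ A := by
    intro k
    have h1 := geo (p * k)
    rw [← Nat.mul_add] at h1
    have h2 := (hG (g ^ (p * (N + k)))).2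
    have h3 : z ^ k ≤ z ^ wl S (g ^ (p * (N + k))) :=
      pow_le_pow_right₀ hz.le (le_trans (by omega) (lin (N + k)))
    have h4 : a (p * (N + k)) * z ^ k ≤ A :=
      (mul_le_mul_of_nonneg_left h3 (hG _).1.le).trans h2
    have h5 := mul_le_mul_of_nonneg_right h1 (by positivity : 0 ≤ z ^ k)
    rw [mul_pow, ← pow_mul, ← mul_assoc]
    linarith
  have a0 : 0 < a (p * N) := (hG _).1
  obtain ⟨k, hk⟩ := pow_unbounded_of_one_lt (A / a (p * N)) hθz
  rw [div_lt_iff₀ a0] at hk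
  have := fin k
  linarith

end HarmonicBoundary
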